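/- Let β ∈ ℬ and suppose φ, φ′ are positive roots with β = φ + φ′. Then φ and φ′ both lie in E(β) \ {β}, i.e. (φ,β) > 0 and (φ′,β) > 0, and φ, φ′ are Heisenberg twins: each is the unique element of E(β) \ {β} whose sum with the other equals β. -/

import Mathlib

open scoped InnerProductSpace BigOperators

structure RootSystemData (V : Type*) [NormedAddCommGroup V] [InnerProductSpace ℝ V] where
  Δ : Set V
  finite : Δ.Finite
  span_top : Submodule.span ℝ Δ = ⊤
  zero_not_mem : (0 : V) ∉ Δ
  neg_mem : ∀ α ∈ Δ, -α ∈ Δ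
  reduced : ∀ α ∈ Δ, ∀ t : ℝ, t • α ∈ Δ → t = 1 ∨ t = -1
  crystal : ∀ α ∈ Δ, ∀ β ∈ Δ, ∃ n : ℤ, 2 * ⟪α, β⟫_ℝ = (n : ℝ) * ⟪β, β⟫_ℝ
  reflect_mem : ∀ α ∈ Δ, ∀ β ∈ Δ, α - (2 * ⟪α, β⟫_ℝ / ⟪β, β⟫_ℝ) • β ∈ Δ
  Pos : Set V
  pos_subset : Pos ⊆ Δ
  mem_or_neg : ∀ α ∈ Δ, α ∈ Pos ∨ -α ∈ Pos
  not_neg_mem : ∀ α ∈ Pos, -α ∉ Pos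
  pos_add : ∀ α ∈ Pos, ∀ β ∈ Pos, α + β ∈ Δ → α + β ∈ Pos

namespace RootSystemData

variable {V : Type*} [NormedAddCommGroup V] [InnerProductSpace ℝ V] (R : RootSystemData V)

/-- The set of simple roots: indecomposable positive roots. -/
def Simple : Set V := {α ∈ R.Pos | ¬ ∃ β ∈ R.Pos, ∃ γ ∈ R.Pos, α = β + γ}

/-- The support `Π(φ)` of a positive root: the simple roots needed to express `φ`. -/
def support (φ : V) : Set V := {α ∈ R.Simple | φ ∉ Submodule.span ℝ (R.Simple \ {α})}

/-- The root subsystem `Δ(φ)`: all roots lying in the span of the support of `φ`. -/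
def sub (φ : V) : Set V := {ψ ∈ R.Δ | ψ ∈ Submodule.span ℝ (R.support φ)}

/-- The positive roots `Δ(φ)₊` of the subsystem `Δ(φ)`. -/
def posSub (φ : V) : Set V := R.sub φ ∩ R.Pos

/-- `x` is a nonnegative integer combination of positive roots. -/
def NonnegComb (x : V) : Prop :=
  ∃ c : V →₀ ℕ, ↑c.support ⊆ R.Pos ∧ x = c.sum fun α n => (n : ℝ) • α

/-- `β` is the highest root of the subset `S`. -/
def IsHighest (S : Set V) (β : V) : Prop :=
  β ∈ S ∧ β ∈ R.Pos ∧ ∀ ψ ∈ S, R.NonnegComb (β - ψ)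

/-- `β` is locally high: it is the highest root of `Δ(β)`. -/
def LocallyHigh (β : V) : Prop := β ∈ R.Pos ∧ R.IsHighest (R.sub β) β

/-- `E(β) = {φ ∈ Δ(β) : (φ,β) > 0}`. -/
def E (β : V) : Set V := {φ ∈ R.sub β | 0 < ⟪φ, β⟫_ℝ}

/-- `Δ(β)° = {φ ∈ Δ(β) : (φ,β) = 0}`. -/
def orth (β : V) : Set V := {φ ∈ R.sub β | ⟪φ, β⟫_ℝ = 0}

/-- Strong orthogonality of two roots. -/
def StronglyOrth (φ ψ : V) : Prop := φ + ψ ∉ R.Δ ∧ φ - ψ ∉ R.Δ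


/-- Half the sum of the positive roots of `Δ(β)`. -/
noncomputable def rho (β : V) : V := (2⁻¹ : ℝ) • ∑ᶠ φ ∈ R.posSub β, φ

/-- The dual Coxeter number of `Δ(β)`, `⟨ρ_β, β^∨⟩ + 1`. -/
noncomputable def dualCoxeter (β : V) : ℝ := 2 * ⟪R.rho β, β⟫_ℝ / ⟪β, β⟫_ℝ + 1

end RootSystemData

/-- A finite set of vectors is irreducible if it is nonempty and admits no splitting into
two nonempty mutually orthogonal pieces. -/
def IsIrred {V : Type*} [NormedAddCommGroup V] [InnerProductSpace ℝ V] (S : Set V) : Prop :=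
  S.Nonempty ∧ ¬ ∃ A B : Set V, A ∪ B = S ∧ A ∩ B = ∅ ∧ A.Nonempty ∧ B.Nonempty ∧
    ∀ a ∈ A, ∀ b ∈ B, ⟪a, b⟫_ℝ = 0

/-- `C` is an irreducible component of `S`. -/
def IsComponent {V : Type*} [NormedAddCommGroup V] [InnerProductSpace ℝ V]
    (S C : Set V) : Prop :=
  C ⊆ S ∧ IsIrred C ∧ ∀ a ∈ C, ∀ b ∈ S \ C, ⟪a, b⟫_ℝ = 0

/-- The reflection `s_β` in the (co)vector `β`. -/
noncomputable def reflectRoot {V : Type*} [NormedAddCommGroup V] [InnerProductSpace ℝ V]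
    (β v : V) : V := v - (2 * ⟪v, β⟫_ℝ / ⟪β, β⟫_ℝ) • β

namespace RootSystemData

variable {V : Type*} [NormedAddCommGroup V] [InnerProductSpace ℝ V] (R : RootSystemData V)

/-- A chain cascade: a nonempty list whose head is the highest root of an irreducible
component of `Δ`, and each subsequent entry is the highest root of an irreducible component
of `Δ(previous)°`. -/
def IsChainCascade (l : List V) : Prop :=
  l ≠ [] ∧
  (∀ b ∈ l.head?, ∃ C, IsComponent R.Δ C ∧ R.IsHighest C b) ∧
  l.Chain' fun γ δ => ∃ C, IsComponent (R.orth γ) C ∧ R.IsHighest C δ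

/-- The cascade `ℬ` of roots: all positive roots belonging to some chain cascade. -/
def cascade : Set V := {β | ∃ l, R.IsChainCascade l ∧ β ∈ l}

/-- `l` is the chain cascade `C(φ)` associated to the positive root `φ`. -/
def IsCascadeChainOf (φ : V) (l : List V) : Prop :=
  R.IsChainCascade l ∧ (∀ β ∈ l, φ ∈ R.sub β) ∧
  (∀ β ∈ l.dropLast, ⟪φ, β⟫_ℝ = 0) ∧ ∀ β ∈ l.getLast?, 0 < ⟪φ, β⟫_ℝ

end RootSystemData

namespace RootSystemData

variable {V : Type*} [NormedAddCommGroup V] [InnerProductSpace ℝ V] (R : RootSystemData V)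

lemma inner_self_pos {α : V} (hα : α ∈ R.Δ) : 0 < ⟪α, α⟫_ℝ :=
  real_inner_self_pos.2 fun h => R.zero_not_mem (h ▸ hα)

/-- If two roots form an obtuse angle and are not opposite, their sum is a root. -/
lemma add_mem_of_inner_neg {α β : V} (hα : α ∈ R.Δ) (hβ : β ∈ R.Δ)
    (h : ⟪α, β⟫_ℝ < 0) (hne : α + β ≠ 0) : α + β ∈ R.Δ := by
  obtain ⟨n, hn⟩ := R.crystal α hα β hβ
  obtain ⟨m, hm⟩ := R.crystal β hβ α hα
  have hα0 := R.inner_self_pos hα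
  have hβ0 := R.inner_self_pos hβ
  have hsymm := real_inner_comm α β
  have hn0 : n < 0 := by
    have : (n : ℝ) < 0 := by by_contra! hc; nlinarith [mul_nonneg hc hβ0.le]
    exact_mod_cast this
  have hm0 : m < 0 := by
    have : (m : ℝ) < 0 := by by_contra! hc; nlinarith [mul_nonneg hc hα0.le]
    exact_mod_cast this
  by_cases hn1 : n = -1
  · have := R.reflect_mem α hα β hβ
    rw [hn, hn1, mul_div_assoc, div_self hβ0.ne'] at this
    simpa using this
  by_cases hm1 : m = -1
  · have := R.reflect_mem β hβ α hα
    rw [hm, hm1, mul_div_assoc, div_self hα0.ne'] at this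
    simpa [add_comm] using this
  exfalso
  have hn2 : (n : ℝ) ≤ -2 := by exact_mod_cast (by omega : n ≤ -2)
  have hm2 : (m : ℝ) ≤ -2 := by exact_mod_cast (by omega : m ≤ -2)
  have hpos := real_inner_self_pos.2 hne
  rw [real_inner_add_add_self] at hpos
  nlinarith [mul_le_mul_of_nonneg_right hn2 hβ0.le, mul_le_mul_of_nonneg_right hm2 hα0.le]

lemma add_ne_zero_of_pos {α β : V} (hα : α ∈ R.Pos) (hβ : β ∈ R.Pos) : α + β ≠ 0 :=
  fun h => R.not_neg_mem α hα (neg_eq_of_add_eq_zero_right h ▸ hβ)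

/-- A nonempty sum of positive roots does not vanish. -/
lemma multiset_sum_ne_zero (s : Multiset V) (hs : ∀ α ∈ s, α ∈ R.Pos) (hs0 : s ≠ 0) :
    s.sum ≠ 0 := by
  induction hk : s.card using Nat.strong_induction_on generalizing s with
  | _ k ih =>
  intro hsum
  obtain ⟨a, ha⟩ := Multiset.exists_mem_of_ne_zero hs0
  obtain ⟨t, rfl⟩ := Multiset.exists_cons_of_mem ha
  have haP := hs a ha
  have ha0 := R.inner_self_pos (R.pos_subset haP)
  have hsum' : t.sum = -a := by
    rw [Multiset.sum_cons] at hsum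
    exact (neg_eq_of_add_eq_zero_right hsum).symm
  obtain ⟨b, hb, hab⟩ : ∃ b ∈ t, ⟪a, b⟫_ℝ < 0 := by
    by_contra! hc
    have h : 0 ≤ (t.map fun b => ⟪a, b⟫_ℝ).sum :=
      Multiset.sum_nonneg fun x hx => by
        obtain ⟨b, hb, rfl⟩ := Multiset.mem_map.1 hx
        exact hc b hb
    have h' : (t.map fun b => ⟪a, b⟫_ℝ).sum = ⟪a, t.sum⟫_ℝ :=
      (map_multiset_sum (innerₗ V a) t).symm
    rw [h', hsum', inner_neg_right] at h
    linarith
  obtain ⟨u, rfl⟩ := Multiset.exists_cons_of_mem hb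
  have hbP := hs b (by simp)
  have habP := R.pos_add a haP b hbP (R.add_mem_of_inner_neg (R.pos_subset haP)
    (R.pos_subset hbP) hab (R.add_ne_zero_of_pos haP hbP))
  refine ih (u.card + 1) (by simp [← hk]) ((a + b) ::ₘ u) ?_ (by simp) (by simp) ?_
  · intro x hx
    rcases Multiset.mem_cons.1 hx with rfl | hx
    · exact habP
    · exact hs x (by simp [hx])
  · simpa [add_assoc] using hsum

lemma add_ne_zero_of_mem_closure {α m : V} (hα : α ∈ R.Pos)
    (hm : m ∈ AddSubmonoid.closure R.Pos) : α + m ≠ 0 := by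
  obtain ⟨s, hs, rfl⟩ := AddSubmonoid.exists_multiset_of_mem_closure hm
  rw [← Multiset.sum_cons]
  refine R.multiset_sum_ne_zero _ (fun x hx => ?_) (by simp)
  rcases Multiset.mem_cons.1 hx with rfl | hx
  exacts [hα, hs x hx]

lemma NonnegComb.mem_closure {x : V} (h : R.NonnegComb x) :
    x ∈ AddSubmonoid.closure R.Pos := by
  obtain ⟨c, hc, rfl⟩ := h
  refine AddSubmonoid.sum_mem _ fun α hα => ?_
  simp only [Nat.cast_smul_eq_nsmul]
  exact nsmul_mem (AddSubmonoid.subset_closure (hc hα)) _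

lemma IsHighest.add_notMem {S : Set V} {β ψ : V} (h : R.IsHighest S β) (hψ : ψ ∈ R.Pos) :
    β + ψ ∉ S := fun hmem =>
  R.add_ne_zero_of_mem_closure hψ (NonnegComb.mem_closure R (h.2.2 _ hmem)) (by abel)

lemma mem_closure_simple {φ : V} (hφ : φ ∈ R.Pos) : φ ∈ AddSubmonoid.closure R.Simple := by
  have : Finite R.Pos := R.finite.subset R.pos_subset
  let r : R.Pos → R.Pos → Prop := fun x y =>
    ∃ s : Multiset V, s ≠ 0 ∧ (∀ α ∈ s, α ∈ R.Pos) ∧ (y : V) = x + s.sum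
  have : IsTrans R.Pos r := ⟨by
    rintro x y z ⟨s, hs0, hs, hxy⟩ ⟨t, -, ht, hyz⟩
    refine ⟨s + t, by simp [hs0], fun α hα => ?_, by rw [hyz, hxy, Multiset.sum_add, add_assoc]⟩
    rcases Multiset.mem_add.1 hα with h | h
    exacts [hs α h, ht α h]⟩
  have : Std.Irrefl r := ⟨by
    rintro x ⟨s, hs0, hs, hx⟩
    exact R.multiset_sum_ne_zero s hs hs0 (by simpa using hx)⟩
  have hwf : WellFounded r := Finite.wellFounded_of_trans_of_irrefl r
  suffices h : ∀ x : R.Pos, (x : V) ∈ AddSubmonoid.closure R.Simple from h ⟨φ, hφ⟩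
  intro x
  induction x using hwf.induction with
  | _ x ih =>
  by_cases hx : (x : V) ∈ R.Simple
  · exact AddSubmonoid.subset_closure hx
  · obtain ⟨β, hβ, γ, hγ, hxe⟩ : ∃ β ∈ R.Pos, ∃ γ ∈ R.Pos, (x : V) = β + γ := by
      by_contra hc
      exact hx ⟨x.2, hc⟩
    rw [hxe]
    refine add_mem (ih ⟨β, hβ⟩ ⟨{γ}, by simp, by simpa using hγ, by simpa using hxe⟩)
      (ih ⟨γ, hγ⟩ ⟨{β}, by simp, by simpa using hβ, by simpa [add_comm] using hxe⟩)

/-- Distinct simple roots form a non-acute angle. -/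
lemma inner_simple_nonpos {α β : V} (hα : α ∈ R.Simple) (hβ : β ∈ R.Simple) (hne : α ≠ β) :
    ⟪α, β⟫_ℝ ≤ 0 := by
  by_contra! h
  have hd : α + -β ∈ R.Δ := R.add_mem_of_inner_neg (R.pos_subset hα.1)
    (R.neg_mem _ (R.pos_subset hβ.1)) (by simpa using h) (by rwa [← sub_eq_add_neg, sub_ne_zero])
  rcases R.mem_or_neg _ hd with h | h
  · exact hα.2 ⟨β, hβ.1, _, h, by abel⟩
  · exact hβ.2 ⟨α, hα.1, _, h, by abel⟩

lemma sum_nsmul_eq_zero [Fintype R.Simple] {n : R.Simple → ℕ}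
    (h : ∑ i, n i • (i : V) = 0) (i : R.Simple) : n i = 0 := by
  classical
  by_contra hi
  obtain ⟨k, hk⟩ := Nat.exists_eq_succ_of_ne_zero hi
  rw [← Finset.add_sum_erase _ _ (Finset.mem_univ i), hk, succ_nsmul', add_assoc] at h
  have hmem (j : R.Simple) (l : ℕ) : l • (j : V) ∈ AddSubmonoid.closure R.Pos :=
    nsmul_mem (AddSubmonoid.subset_closure j.2.1) l
  exact R.add_ne_zero_of_mem_closure i.2.1
    (add_mem (hmem i k) (AddSubmonoid.sum_mem _ fun j _ => hmem j _)) h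

lemma sum_zsmul_eq_zero [Fintype R.Simple] {c : R.Simple → ℤ}
    (h : ∑ i, c i • (i : V) = 0) : c = 0 := by
  have hsub : ∑ i, (c i).toNat • (i : V) = ∑ i, (-c i).toNat • (i : V) := by
    rw [← sub_eq_zero, ← Finset.sum_sub_distrib, ← h]
    refine Finset.sum_congr rfl fun i _ => ?_
    rw [← natCast_zsmul, ← natCast_zsmul, ← sub_smul, Int.toNat_sub_toNat_neg]
  have hle : ⟪∑ i, (c i).toNat • (i : V), ∑ i, (-c i).toNat • (i : V)⟫_ℝ ≤ 0 := by
    simp only [← Nat.cast_smul_eq_nsmul ℝ, sum_inner, inner_sum, inner_smul_left,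
      inner_smul_right, RCLike.conj_to_real, Finset.mul_sum]
    refine Finset.sum_nonpos fun j _ => Finset.sum_nonpos fun i _ => ?_
    by_cases hij : i = j
    · subst hij
      rcases le_total (c i) 0 with hc | hc
      · simp [Int.toNat_of_nonpos hc]
      · simp [Int.toNat_of_nonpos (neg_nonpos.2 hc)]
    · have := R.inner_simple_nonpos i.2 j.2 (Subtype.coe_injective.ne hij)
      exact mul_nonpos_of_nonneg_of_nonpos (Nat.cast_nonneg _)
        (mul_nonpos_of_nonneg_of_nonpos (Nat.cast_nonneg _) this)
  rw [← hsub] at hle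
  have h0 := real_inner_self_nonpos.1 hle
  have h1 := R.sum_nsmul_eq_zero h0
  have h2 := R.sum_nsmul_eq_zero (hsub ▸ h0)
  funext i
  have := h1 i
  have := h2 i
  simp only [Pi.zero_apply]
  omega

lemma linearIndependent_simple : LinearIndependent ℝ (fun i : R.Simple => (i : V)) := by
  classical
  have : Finite R.Simple := R.finite.subset fun _ h => R.pos_subset h.1
  have := Fintype.ofFinite R.Simple
  choose M hM using fun i j : R.Simple =>
    R.crystal i (R.pos_subset i.2.1) j (R.pos_subset j.2.1)
  have hpair (c : R.Simple → ℝ) (j : R.Simple) :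
      2 * ⟪∑ i, c i • (i : V), j⟫_ℝ = (∑ i, c i * M i j) * ⟪(j : V), j⟫_ℝ := by
    simp only [sum_inner, inner_smul_left, RCLike.conj_to_real, Finset.mul_sum, Finset.sum_mul]
    refine Finset.sum_congr rfl fun i _ => ?_
    rw [mul_assoc, ← hM]
    ring
  have hdet : (Matrix.of M).det ≠ 0 := by
    intro h
    obtain ⟨c, hc0, hc⟩ := Matrix.exists_vecMul_eq_zero_iff.2 h
    refine hc0 (R.sum_zsmul_eq_zero ?_)
    simp only [← Int.cast_smul_eq_zsmul ℝ]
    rw [← inner_self_eq_zero (𝕜 := ℝ), inner_sum]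
    refine Finset.sum_eq_zero fun j _ => ?_
    have hj : ∑ i, (c i : ℝ) * M i j = 0 := by exact_mod_cast congrFun hc j
    have := hpair (fun i => c i) j
    rw [hj, zero_mul] at this
    rw [inner_smul_right]
    simp only [mul_eq_zero] at this ⊢
    exact Or.inr (this.resolve_left two_ne_zero)
  rw [Fintype.linearIndependent_iff]
  intro c hc
  have hdet' : ((Matrix.of M).map (Int.castRingHom ℝ)).det ≠ 0 := by
    rw [← RingHom.mapMatrix_apply, ← RingHom.map_det]
    simpa using hdet
  refine congrFun (Matrix.eq_zero_of_vecMul_eq_zero hdet' (funext fun j => ?_))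
  have := hpair c j
  rw [hc, inner_zero_left, mul_zero] at this
  exact (mul_eq_zero.1 this.symm).resolve_right (R.inner_self_pos (R.pos_subset j.2.1)).ne'

/-- The coordinate function of a simple root. -/
lemma exists_coord {α : V} (hα : α ∈ R.Simple) :
    ∃ f : V →ₗ[ℝ] ℝ, f α = 1 ∧ ∀ δ ∈ R.Simple, δ ≠ α → f δ = 0 := by
  have hv := R.linearIndependent_simple
  let b := Module.Basis.span hv
  obtain ⟨f, hf⟩ := (b.coord ⟨α, hα⟩).exists_extend
  have key (δ : R.Simple) : f δ = b.coord ⟨α, hα⟩ (b δ) := by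
    rw [← hf, LinearMap.comp_apply, Submodule.subtype_apply, Module.Basis.span_apply]
  refine ⟨f, by simp [key ⟨α, hα⟩], fun δ hδ hne => ?_⟩
  rw [key ⟨δ, hδ⟩, Module.Basis.coord_apply, Module.Basis.repr_self]
  exact Finsupp.single_eq_of_ne' (by simpa using hne)

lemma exists_coeff {φ : V} (hφ : φ ∈ R.Pos) :
    ∃ c : V →₀ ℕ, ↑c.support ⊆ R.Simple ∧ φ = c.sum fun α n => n • α := by
  classical
  refine AddSubmonoid.closure_induction ?_ ?_ ?_ (R.mem_closure_simple hφ)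
  · intro α hα
    refine ⟨Finsupp.single α 1, ?_, by simp⟩
    intro x hx
    rw [Finset.mem_coe, Finsupp.mem_support_single] at hx
    exact hx.1 ▸ hα
  · exact ⟨0, by simp, by simp⟩
  · rintro x y - - ⟨c, hc, rfl⟩ ⟨d, hd, rfl⟩
    refine ⟨c + d, fun x hx => ?_, ?_⟩
    · rcases Finset.mem_union.1 (Finsupp.support_add hx) with h | h
      exacts [hc h, hd h]
    · rw [Finsupp.sum_add_index' (h := fun (α : V) (n : ℕ) => n • α) zero_nsmul add_nsmul]

lemma mem_support_iff {φ α : V} (hα : α ∈ R.Simple) {c : V →₀ ℕ}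
    (hc : ↑c.support ⊆ R.Simple) (hφ : φ = c.sum fun α n => n • α) :
    α ∈ R.support φ ↔ c α ≠ 0 := by
  constructor
  · rintro ⟨-, h⟩ h0
    refine h ?_
    rw [hφ]
    refine Submodule.sum_mem _ fun δ hδ => nsmul_mem (Submodule.subset_span ?_) _
    refine ⟨hc hδ, ?_⟩
    rintro rfl
    exact Finsupp.mem_support_iff.1 hδ h0
  · intro h0
    refine ⟨hα, fun hmem => h0 ?_⟩
    obtain ⟨f, hf1, hf0⟩ := R.exists_coord hα
    have hker : Submodule.span ℝ (R.Simple \ {α}) ≤ LinearMap.ker f :=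
      Submodule.span_le.2 fun δ hδ => hf0 δ hδ.1 hδ.2
    have h : f φ = 0 := hker hmem
    rw [hφ, Finsupp.sum, map_sum, Finset.sum_eq_single α, map_nsmul, hf1] at h
    · simpa using h
    · intro δ hδ hne
      rw [map_nsmul, hf0 δ (hc hδ) hne, smul_zero]
    · intro hn
      rw [Finsupp.notMem_support_iff.1 hn, zero_smul, map_zero]

lemma mem_sub_self {φ : V} (hφ : φ ∈ R.Pos) : φ ∈ R.sub φ := by
  refine ⟨R.pos_subset hφ, ?_⟩
  obtain ⟨c, hc, he⟩ := R.exists_coeff hφ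
  have : (c.sum fun α n => n • α) ∈ Submodule.span ℝ (R.support φ) :=
    Submodule.sum_mem _ fun δ hδ => nsmul_mem (Submodule.subset_span
      ((R.mem_support_iff (hc hδ) hc he).2 (Finsupp.mem_support_iff.1 hδ))) _
  rwa [← he] at this

lemma support_subset_of_mem_sub {φ γ : V} (h : φ ∈ R.sub γ) : R.support φ ⊆ R.support γ := by
  intro α hα
  by_contra hn
  have hsub : R.support γ ⊆ R.Simple \ {α} := fun δ hδ =>
    ⟨hδ.1, fun he => hn (Set.mem_singleton_iff.1 he ▸ hδ)⟩
  exact hα.2 (Submodule.span_mono hsub h.2)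

lemma sub_subset_of_mem_sub {φ γ : V} (h : φ ∈ R.sub γ) : R.sub φ ⊆ R.sub γ :=
  fun _ hψ => ⟨hψ.1, Submodule.span_mono (R.support_subset_of_mem_sub h) hψ.2⟩

lemma support_subset_support_add {φ ψ : V} (hφ : φ ∈ R.Pos) (hψ : ψ ∈ R.Pos) :
    R.support φ ⊆ R.support (φ + ψ) := by
  classical
  intro α hα
  obtain ⟨c, hc, hce⟩ := R.exists_coeff hφ
  obtain ⟨d, hd, hde⟩ := R.exists_coeff hψ
  have hcd : ↑(c + d).support ⊆ R.Simple := fun x hx => by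
    rcases Finset.mem_union.1 (Finsupp.support_add hx) with h | h
    exacts [hc h, hd h]
  have he : φ + ψ = (c + d).sum fun α n => n • α := by
    rw [Finsupp.sum_add_index' (h := fun (α : V) (n : ℕ) => n • α) zero_nsmul add_nsmul, ← hce, ← hde]
  rw [R.mem_support_iff hα.1 hcd he]
  have := (R.mem_support_iff hα.1 hc hce).1 hα
  simp [this]

lemma mem_sub_add_left {φ ψ : V} (hφ : φ ∈ R.Pos) (hψ : ψ ∈ R.Pos) : φ ∈ R.sub (φ + ψ) :=
  ⟨R.pos_subset hφ,
    Submodule.span_mono (R.support_subset_support_add hφ hψ) (R.mem_sub_self hφ).2⟩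

/-- If `γ` is nonnegative on `Δ(γ)₊`, then every positive root `β` of `Δ(γ)°` satisfies
`Δ(β) ⊆ Δ(γ)°`. -/
lemma sub_subset_orth {β γ : V} (hγ : ∀ ψ ∈ R.posSub γ, 0 ≤ ⟪ψ, γ⟫_ℝ) (hβ : β ∈ R.Pos)
    (hβγ : β ∈ R.orth γ) : R.sub β ⊆ R.orth γ := by
  intro ψ hψ
  refine ⟨R.sub_subset_of_mem_sub hβγ.1 hψ, ?_⟩
  obtain ⟨c, hc, he⟩ := R.exists_coeff hβ
  have hsupp {α : V} (hα : α ∈ R.support β) : 0 ≤ ⟪α, γ⟫_ℝ :=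
    hγ α ⟨⟨R.pos_subset hα.1.1,
      Submodule.subset_span (R.support_subset_of_mem_sub hβγ.1 hα)⟩, hα.1.1⟩
  have hzero : ∑ α ∈ c.support, (c α : ℝ) * ⟪α, γ⟫_ℝ = 0 := by
    rw [← hβγ.2]
    conv_rhs => rw [he, Finsupp.sum, sum_inner]
    refine Finset.sum_congr rfl fun α _ => ?_
    rw [← Nat.cast_smul_eq_nsmul ℝ, real_inner_smul_left]
  rw [Finset.sum_eq_zero_iff_of_nonneg fun α hα => mul_nonneg (Nat.cast_nonneg _)
    (hsupp ((R.mem_support_iff (hc hα) hc he).2 (Finsupp.mem_support_iff.1 hα)))] at hzero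
  have hker : Submodule.span ℝ (R.support β) ≤ LinearMap.ker (innerₗ V γ) := by
    refine Submodule.span_le.2 fun α hα => ?_
    have hα0 := (R.mem_support_iff hα.1 hc he).1 hα
    have := (mul_eq_zero.1 (hzero α (Finsupp.mem_support_iff.2 hα0))).resolve_left
      (Nat.cast_ne_zero.2 hα0)
    rwa [real_inner_comm] at this
  rw [real_inner_comm]
  exact hker hψ.2

/-- `β` is the highest root of an irreducible component of a set that contains `Δ(β)`
and is closed under those sums of two elements that are roots. -/
def IsHighestInClosed (β : V) : Prop :=
  ∃ S : Set V, R.sub β ⊆ S ∧ (∀ φ ∈ S, ∀ ψ ∈ S, φ + ψ ∈ R.Δ → φ + ψ ∈ S) ∧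
    ∃ C, IsComponent S C ∧ R.IsHighest C β

lemma orth_add_mem {γ φ ψ : V} (hφ : φ ∈ R.orth γ) (hψ : ψ ∈ R.orth γ)
    (h : φ + ψ ∈ R.Δ) : φ + ψ ∈ R.orth γ :=
  ⟨⟨h, add_mem hφ.1.2 hψ.1.2⟩, by rw [inner_add_left, hφ.2, hψ.2, add_zero]⟩

variable {R}

lemma IsHighestInClosed.inner_nonneg {β : V} (h : R.IsHighestInClosed β) {ψ : V}
    (hψ : ψ ∈ R.posSub β) : 0 ≤ ⟪ψ, β⟫_ℝ := by
  obtain ⟨S, hβS, hadd, C, hC, hβ⟩ := h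
  by_contra! hneg
  have hψS := hβS hψ.1
  have hψC : ψ ∈ C := by
    by_contra hn
    have := hC.2.2 β hβ.1 ψ ⟨hψS, hn⟩
    rw [real_inner_comm] at this
    exact hneg.ne this
  have hsum : β + ψ ∈ R.Δ := R.add_mem_of_inner_neg (R.pos_subset hβ.2.1) hψ.1.1
    (by rwa [real_inner_comm]) (R.add_ne_zero_of_pos hβ.2.1 hψ.2)
  have hsumS := hadd β (hC.1 hβ.1) ψ hψS hsum
  have hn := IsHighest.add_notMem R hβ hψ.2
  have h1 := hC.2.2 β hβ.1 _ ⟨hsumS, hn⟩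
  have h2 := hC.2.2 ψ hψC _ ⟨hsumS, hn⟩
  have h3 := R.inner_self_pos hsum
  rw [inner_add_left, h1, h2, add_zero] at h3
  exact h3.false

/-- If `β = φ + ψ` with `φ`, `ψ` positive roots, then `(ψ, β) > 0`. -/
lemma IsHighestInClosed.inner_pos {φ ψ : V} (h : R.IsHighestInClosed (φ + ψ))
    (hφ : φ ∈ R.Pos) (hψ : ψ ∈ R.Pos) : 0 < ⟪ψ, φ + ψ⟫_ℝ := by
  have hψsub : ψ ∈ R.sub (φ + ψ) := add_comm ψ φ ▸ R.mem_sub_add_left hψ hφ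
  refine (h.inner_nonneg ⟨hψsub, hψ⟩).lt_of_ne' fun h0 => ?_
  obtain ⟨S, hβS, hadd, C, hC, hβ⟩ := h
  have hψ0 := R.inner_self_pos (R.pos_subset hψ)
  have hrefl := R.reflect_mem φ (R.pos_subset hφ) ψ (R.pos_subset hψ)
  have hcoef : 2 * ⟪φ, ψ⟫_ℝ / ⟪ψ, ψ⟫_ℝ = -2 := by
    rw [inner_add_right, real_inner_comm] at h0
    rw [div_eq_iff hψ0.ne']
    linarith
  have hsum : φ + ψ + ψ ∈ R.Δ := by
    rw [hcoef] at hrefl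
    convert hrefl using 1
    module
  have hsumS := hadd _ (hC.1 hβ.1) ψ (hβS hψsub) hsum
  have h1 := hC.2.2 _ hβ.1 _ ⟨hsumS, IsHighest.add_notMem R hβ hψ⟩
  rw [inner_add_right, real_inner_comm ψ, h0, add_zero] at h1
  exact (R.inner_self_pos (R.pos_subset hβ.2.1)).ne' h1

lemma IsHighestInClosed.of_orth {γ δ : V} (hγ : R.IsHighestInClosed γ)
    (h : ∃ C, IsComponent (R.orth γ) C ∧ R.IsHighest C δ) : R.IsHighestInClosed δ := by
  obtain ⟨C, hC, hδ⟩ := h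
  exact ⟨R.orth γ,
    R.sub_subset_orth (fun _ hψ => hγ.inner_nonneg hψ) hδ.2.1 (hC.1 hδ.1),
    fun _ hφ _ hψ => R.orth_add_mem hφ hψ, C, hC, hδ⟩

lemma isHighestInClosed_of_mem_cascade {β : V} (hβ : β ∈ R.cascade) :
    R.IsHighestInClosed β := by
  obtain ⟨l, ⟨-, hhead, hchain⟩, hmem⟩ := hβ
  replace hhead : ∀ b ∈ l.head?, R.IsHighestInClosed b := fun b hb => by
    obtain ⟨C, hC, h⟩ := hhead b hb
    exact ⟨R.Δ, fun _ h => h.1, fun _ _ _ _ h => h, C, hC, h⟩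
  induction l with
  | nil => simp at hmem
  | cons a l ih =>
    have ha := hhead a rfl
    rcases List.mem_cons.1 hmem with rfl | hmem
    · exact ha
    · obtain ⟨h, hl⟩ := List.isChain_cons.1 hchain
      exact ih hmem hl fun b hb => ha.of_orth (h b hb)

end RootSystemData

/-- If `β ∈ ℬ` and `φ, φ′` are positive roots with `β = φ + φ′`, then
`φ, φ′ ∈ E(β) \ {β}` and they are Heisenberg twins: each is the unique element of
`E(β) \ {β}` whose sum with the other is `β`. -/
theorem statement10 {V : Type*} [NormedAddCommGroup V] [InnerProductSpace ℝ V]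
    (R : RootSystemData V) (β : V) (hβ : β ∈ R.cascade)
    (φ φ' : V) (hφ : φ ∈ R.Pos) (hφ' : φ' ∈ R.Pos) (hsum : β = φ + φ') :
    (φ ∈ R.E β ∧ φ ≠ β) ∧ (φ' ∈ R.E β ∧ φ' ≠ β) ∧
    (∀ ψ ∈ R.E β, ψ ≠ β → φ + ψ = β → ψ = φ') ∧
    (∀ ψ ∈ R.E β, ψ ≠ β → ψ + φ' = β → ψ = φ) := by
  subst hsum
  have h := RootSystemData.isHighestInClosed_of_mem_cascade hβ
  have hne {α : V} (hα : α ∈ R.Pos) : α ≠ 0 := fun h0 => R.zero_not_mem (h0 ▸ R.pos_subset hα)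
  refine ⟨⟨⟨R.mem_sub_add_left hφ hφ', ?_⟩, by simpa using hne hφ'⟩,
    ⟨⟨add_comm φ' φ ▸ R.mem_sub_add_left hφ' hφ, h.inner_pos hφ hφ'⟩, by simpa using hne hφ⟩,
    fun ψ _ _ he => add_left_cancel he, fun ψ _ _ he => add_right_cancel he⟩
  rw [add_comm] at h ⊢
  exact h.inner_pos hφ' hφ
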